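/- Let Δ > 0 be an integer that is not a perfect square, and consider the group of rational points on the Pell conic X² − ΔY² = 4 under the group law (r,s) + (t,u) = ((rt + Δsu)/2, (ru + st)/2) with neutral element N = (2,0). A rational point P has finite order (i.e. the m-fold sum m·P equals N for some integer m ≥ 1) if and only if P = (2,0) or P = (−2,0). -/

import Mathlib

/-- The group law on the Pell conic `X² - ΔY² = 4`. -/
def pellAdd (Δ : ℚ) (P Q : ℚ × ℚ) : ℚ × ℚ :=
  ((P.1 * Q.1 + Δ * P.2 * Q.2) / 2, (P.1 * Q.2 + P.2 * Q.1) / 2)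

/-- The map `(x, y) ↦ (x + √Δ y) / 2` turns repeated addition on the Pell conic into powers. -/
theorem pellAdd_iterate_eq_pow {Δ : ℚ} {s : ℝ} (hs : s ^ 2 = Δ) (P : ℚ × ℚ) (n : ℕ) :
    ((((pellAdd Δ P)^[n] (2, 0)).1 : ℝ) + s * (((pellAdd Δ P)^[n] (2, 0)).2 : ℝ)) / 2 =
      (((P.1 : ℝ) + s * (P.2 : ℝ)) / 2) ^ n := by
  induction n with
  | zero => simp
  | succ k ih =>
    rw [Function.iterate_succ_apply', pow_succ', ← ih]
    generalize (pellAdd Δ P)^[k] (2, 0) = Q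
    simp only [pellAdd]
    push_cast
    rw [← hs]
    ring

/-- Let `Δ > 0` be a nonsquare integer. A rational point `P` on the Pell conic
`X² - ΔY² = 4` has finite order under the group law (i.e. the `m`-fold sum `m·P`,
obtained by adding `P` to the neutral element `N = (2,0)` exactly `m` times, equals
`N` for some `m ≥ 1`) if and only if `P = (2,0)` or `P = (-2,0)`. -/
theorem pell_conic_torsion_points (Δ : ℤ) (hΔ : 0 < Δ) (hsq : ¬ IsSquare Δ)
    (P : ℚ × ℚ) (hP : P.1 ^ 2 - (Δ : ℚ) * P.2 ^ 2 = 4) :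
    (∃ m : ℕ, 1 ≤ m ∧ (pellAdd (Δ : ℚ) P)^[m] (2, 0) = (2, 0)) ↔
      P = (2, 0) ∨ P = (-2, 0) := by
  constructor
  · rintro ⟨m, hm, h⟩
    have hΔ' : (0 : ℝ) < Δ := by exact_mod_cast hΔ
    have hs : √(Δ : ℝ) ^ 2 = ((Δ : ℚ) : ℝ) := by
      rw [Real.sq_sqrt hΔ'.le]
      norm_cast
    have hs0 : √(Δ : ℝ) ≠ 0 := (Real.sqrt_pos.mpr hΔ').ne'
    have hpow := pellAdd_iterate_eq_pow hs P m
    obtain ⟨x, y⟩ := P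
    have hP' : (x : ℝ) ^ 2 - √(Δ : ℝ) ^ 2 * (y : ℝ) ^ 2 = 4 := by
      rw [hs]
      exact_mod_cast hP
    generalize √(Δ : ℝ) = s at *
    rw [h] at hpow
    have hα : |((x : ℝ) + s * y) / 2| = 1 := by
      refine (pow_eq_one_iff_of_nonneg (abs_nonneg _) (by omega : m ≠ 0)).mp ?_
      rw [← abs_pow, ← hpow]
      norm_num
    rcases eq_or_eq_neg_of_abs_eq hα with hα | hα
    · left
      have hconj : (x : ℝ) - s * y = 2 := by
        linear_combination hP' / 2 - ((x : ℝ) - s * y) * hα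
      have hx : (x : ℝ) = 2 := by linarith
      have hy : (y : ℝ) = 0 := (mul_eq_zero.mp (by linarith : s * (y : ℝ) = 0)).resolve_left hs0
      exact Prod.ext (by exact_mod_cast hx) (by exact_mod_cast hy)
    · right
      have hconj : (x : ℝ) - s * y = -2 := by
        linear_combination -hP' / 2 + ((x : ℝ) - s * y) * hα
      have hx : (x : ℝ) = -2 := by linarith
      have hy : (y : ℝ) = 0 := (mul_eq_zero.mp (by linarith : s * (y : ℝ) = 0)).resolve_left hs0
      exact Prod.ext (by exact_mod_cast hx) (by exact_mod_cast hy)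
  · rintro (rfl | rfl)
    · exact ⟨1, le_rfl, by norm_num [pellAdd]⟩
    · exact ⟨2, one_le_two, by norm_num [pellAdd]⟩
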